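/- Let l ≥ 1 be an integer and set E(λ₁,λ₂) = −2|λ₁−λ₂| + |λ₁−λ₂+l| + |λ₂−λ₁+l| + 2l + |λ₁+l| + |λ₂+l|. On the region R = {(λ₁,λ₂) ∈ ℤ² : λ₁ > −l > λ₂ and λ₁−λ₂ ≥ l}, the values E(λ₁,λ₂) are nonnegative, each fiber of E over n ∈ ℕ is finite, and in ℤ[[t]] one has (1−t)²·∑_{(λ₁,λ₂)∈R} t^{E(λ₁,λ₂)} = t^{3l}·((l−1) − (l−2)t), i.e. the partial sum over R equals t^{3l}/(1−t)² + (l−2)t^{3l}/(1−t). (This is one of the six partial summations in the proof of Lemma 'monopole Hilbert'.) -/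

import Mathlib

/-- The exponent `E(λ₁,λ₂) = −2|λ₁−λ₂| + |λ₁−λ₂+l| + |λ₂−λ₁+l| + 2l + |λ₁+l| + |λ₂+l|`. -/
def expA (l : ℕ) (p : ℤ × ℤ) : ℤ :=
  -2 * |p.1 - p.2| + |p.1 - p.2 + l| + |p.2 - p.1 + l| + 2 * l + |p.1 + l| + |p.2 + l|

/-- The region `R = {(λ₁,λ₂) : λ₁ > −l > λ₂, λ₁−λ₂ ≥ l}`. -/
def regionR (l : ℕ) : Set (ℤ × ℤ) :=
  {p : ℤ × ℤ | p.1 > -(l : ℤ) ∧ -(l : ℤ) > p.2 ∧ p.1 - p.2 ≥ l}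

theorem expA_eq_of_mem_regionR {l : ℕ} {p : ℤ × ℤ} (hp : p ∈ regionR l) :
    expA l p = 2 * l + p.1 - p.2 := by
  obtain ⟨h₁, h₂, h₃⟩ := hp
  have hl : (0 : ℤ) ≤ l := Int.natCast_nonneg l
  rw [expA, abs_of_nonneg (a := p.1 - p.2) (by omega),
    abs_of_nonneg (a := p.1 - p.2 + l) (by omega),
    abs_of_nonpos (a := p.2 - p.1 + l) (by omega),
    abs_of_nonneg (a := p.1 + l) (by omega), abs_of_nonpos (a := p.2 + l) (by omega)]
  ring

theorem fiber_expA_eq_empty {l n : ℕ} (hn : n < 3 * l) :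
    {p : ℤ × ℤ | p ∈ regionR l ∧ expA l p = n} = ∅ := by
  refine Set.eq_empty_of_forall_notMem fun p ⟨hp, hE⟩ => ?_
  rw [expA_eq_of_mem_regionR hp] at hE
  obtain ⟨h₁, h₂, h₃⟩ := hp
  omega

theorem fiber_expA_eq_image {l n : ℕ} (hn : 3 * l ≤ n) :
    {p : ℤ × ℤ | p ∈ regionR l ∧ expA l p = n} =
      (fun a : ℤ => (a - l, a + l - n)) '' (Finset.Icc (1 : ℤ) (n - 2 * l - 1) : Set ℤ) := by
  ext ⟨x, y⟩
  simp only [Set.mem_ofPred_eq, Set.mem_image, Finset.coe_Icc, Set.mem_Icc, Prod.mk.injEq]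
  constructor
  · rintro ⟨hp, hE⟩
    rw [expA_eq_of_mem_regionR hp] at hE
    obtain ⟨h₁, h₂, h₃⟩ := hp
    dsimp only at h₁ h₂ h₃ hE
    exact ⟨x + l, by omega, by omega, by omega⟩
  · rintro ⟨a, ⟨h₁, h₂⟩, rfl, rfl⟩
    have hp : (a - l, a + l - n) ∈ regionR l := by
      refine ⟨?_, ?_, ?_⟩ <;> dsimp only <;> omega
    refine ⟨hp, ?_⟩
    rw [expA_eq_of_mem_regionR hp]
    ring

theorem finite_fiber_expA (l n : ℕ) :
    {p : ℤ × ℤ | p ∈ regionR l ∧ expA l p = n}.Finite := by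
  rcases lt_or_ge n (3 * l) with hn | hn
  · simp [fiber_expA_eq_empty hn]
  · rw [fiber_expA_eq_image hn]
    exact (Finset.finite_toSet _).image _

theorem ncard_fiber_expA {l : ℕ} (hl : 1 ≤ l) (k : ℕ) :
    (Set.ncard {p : ℤ × ℤ | p ∈ regionR l ∧ expA l p = (k + 3 * l : ℕ)} : ℤ) = l - 1 + k := by
  rw [fiber_expA_eq_image (Nat.le_add_left _ _), Set.ncard_image_of_injective,
    Set.ncard_coe_finset, Int.card_Icc]
  · omega
  · intro a b h
    simpa using congrArg Prod.fst h

open PowerSeries in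
theorem one_sub_X_sq_mul_mk_add_natCast {R : Type*} [CommRing R] (c : R) :
    (1 - X) ^ 2 * PowerSeries.mk (fun k => c + (k : R)) = C c - C (c - 1) * X := by
  have h : (1 - X) * PowerSeries.mk (fun k => c + (k : R)) =
      C (c - 1) + PowerSeries.mk (1 : ℕ → R) := by
    ext (_ | n)
    · simp [sub_mul]
    · simp [sub_mul, coeff_succ_X_mul]
  rw [sq, mul_assoc, h, mul_add, mul_comm (1 - X) (PowerSeries.mk _),
    mk_one_mul_one_sub_eq_one, map_sub, map_one]
  ring

open PowerSeries in
theorem stmt3 (l : ℕ) (hl : 1 ≤ l) :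
    (∀ p ∈ regionR l, 0 ≤ expA l p) ∧
    (∀ n : ℕ, {p : ℤ × ℤ | p ∈ regionR l ∧ expA l p = n}.Finite) ∧
    (1 - X) ^ 2 *
      PowerSeries.mk (fun n => (Set.ncard {p : ℤ × ℤ | p ∈ regionR l ∧ expA l p = n} : ℤ))
      = X ^ (3 * l) * (C ((l : ℤ) - 1) - C ((l : ℤ) - 2) * X) := by
  refine ⟨fun p hp => ?_, finite_fiber_expA l, ?_⟩
  · rw [expA_eq_of_mem_regionR hp]
    obtain ⟨h₁, h₂, h₃⟩ := hp
    omega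
  · have hmk : PowerSeries.mk
        (fun n => (Set.ncard {p : ℤ × ℤ | p ∈ regionR l ∧ expA l p = n} : ℤ)) =
        X ^ (3 * l) * PowerSeries.mk (fun k => (l : ℤ) - 1 + (k : ℤ)) := by
      ext n
      rw [coeff_X_pow_mul', coeff_mk]
      split_ifs with hn
      · obtain ⟨k, rfl⟩ := Nat.exists_eq_add_of_le' hn
        rw [ncard_fiber_expA hl, coeff_mk, Nat.add_sub_cancel]
      · simp [fiber_expA_eq_empty (not_le.mp hn)]
    rw [hmk, mul_left_comm, one_sub_X_sq_mul_mk_add_natCast, sub_sub, one_add_one_eq_two]
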